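/- Quantum teleportation is correct: for every vector φ ∈ ℂ² and all b1, b2 ∈ {0,1}, applying the correction Z^{b1}·X^{b2} to the vector (⟨x_{b1}| ⊗ ⟨b2| ⊗ I₂)((CNOT ⊗ I₂)(φ ⊗ |Φ⁺⟩)) yields (1/2)·φ; that is, after entangling the input with half of a Bell pair, measuring the first qubit in the X basis (outcome b1) and the second in the Z basis (outcome b2), and applying Pauli corrections, the third qubit holds the state φ (with outcome amplitude 1/2 for each of the four outcomes). -/

import Mathlib

open Matrix Kronecker

noncomputable section

abbrev M2 := Matrix (Fin 2) (Fin 2) ℂ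

/-- computational basis ket `|b⟩` of `ℂ²`, as a 2×1 matrix -/
def ket (b : Fin 2) : Matrix (Fin 2) (Fin 1) ℂ := Matrix.of fun i _ => if i = b then 1 else 0

/-- computational basis bra `⟨b|` -/
def bra (b : Fin 2) : Matrix (Fin 1) (Fin 2) ℂ := Matrix.of fun _ j => if j = b then 1 else 0

/-- X-basis bra `⟨x_b| = (⟨0| + (−1)^b ⟨1|)/√2` -/
def braX (b : Fin 2) : Matrix (Fin 1) (Fin 2) ℂ :=
  ((1 : ℂ) / Real.sqrt 2) • (bra 0 + ((-1 : ℂ) ^ (b : ℕ)) • bra 1)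

/-- rank-one projector `|b⟩⟨b|` -/
def proj (b : Fin 2) : M2 := ket b * bra b

/-- Pauli X -/
def Xg : M2 := !![0, 1; 1, 0]

/-- Pauli Z -/
def Zg : M2 := !![1, 0; 0, -1]

/-- CNOT with control on the first factor -/
def CNOT : Matrix (Fin 2 × Fin 2) (Fin 2 × Fin 2) ℂ := proj 0 ⊗ₖ (1 : M2) + proj 1 ⊗ₖ Xg

/-- the Bell state `|Φ⁺⟩ = (|00⟩+|11⟩)/√2`, as a 4×1 matrix -/
def bellPhi : Matrix (Fin 2 × Fin 2) (Fin 1 × Fin 1) ℂ :=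
  ((1 : ℂ) / Real.sqrt 2) • (ket 0 ⊗ₖ ket 0 + ket 1 ⊗ₖ ket 1)

/-- index bookkeeping: drop two trivial `Fin 1` factors -/
def er : (Fin 1 × (Fin 1 × Fin 2)) ≃ Fin 2 := (Equiv.uniqueProd _ _).trans (Equiv.uniqueProd _ _)
def ec : (Fin 1 × (Fin 1 × Fin 1)) ≃ Fin 1 := (Equiv.uniqueProd _ _).trans (Equiv.uniqueProd _ _)

/-- Before correction, the third qubit holds `(1/2) • ∑ₐ (-1)^(b1 a) φₐ |a + b2⟩`. -/
lemma measured_apply (φ : Matrix (Fin 2) (Fin 1) ℂ) (b1 b2 i : Fin 2) (j : Fin 1) :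
    Matrix.reindex er ec
        ((braX b1 ⊗ₖ (bra b2 ⊗ₖ (1 : M2))) *
          Matrix.reindex (Equiv.prodAssoc (Fin 2) (Fin 2) (Fin 2))
            (Equiv.prodAssoc (Fin 2) (Fin 2) (Fin 2)) (CNOT ⊗ₖ (1 : M2)) *
          (φ ⊗ₖ bellPhi)) i j =
      (1 / 2 : ℂ) * ((-1) ^ ((b1 : ℕ) * ((i + b2 : Fin 2) : ℕ)) * φ (i + b2) j) := by
  have hs : ((Real.sqrt 2 : ℂ))⁻¹ * (Real.sqrt 2 : ℂ)⁻¹ = 1 / 2 := by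
    rw [← mul_inv, ← Complex.ofReal_mul, Real.mul_self_sqrt (by norm_num)]
    norm_num
  rw [← hs]
  fin_cases j
  fin_cases b1 <;> fin_cases b2 <;> fin_cases i <;>
    simp [er, ec, Matrix.mul_apply, Fintype.sum_prod_type, braX, bra, ket, proj, CNOT, Xg,
      bellPhi, Matrix.one_apply] <;> ring

/-- Quantum teleportation is correct: entangle the input `φ` with half of a Bell pair via
CNOT, measure qubit 1 in the X basis (outcome `b1`) and qubit 2 in the Z basis (outcome
`b2`), apply the Pauli correction `Z^{b1}·X^{b2}`; the third qubit then holds `(1/2)·φ`. -/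
theorem teleportation_correct (φ : Matrix (Fin 2) (Fin 1) ℂ) (b1 b2 : Fin 2) :
    (Zg ^ (b1 : ℕ) * Xg ^ (b2 : ℕ)) *
      Matrix.reindex er ec
        ((braX b1 ⊗ₖ (bra b2 ⊗ₖ (1 : M2))) *
          Matrix.reindex (Equiv.prodAssoc (Fin 2) (Fin 2) (Fin 2))
            (Equiv.prodAssoc (Fin 2) (Fin 2) (Fin 2)) (CNOT ⊗ₖ (1 : M2)) *
          (φ ⊗ₖ bellPhi)) = ((1 : ℂ) / 2) • φ := by
  ext i j
  rw [Matrix.mul_apply]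
  simp only [measured_apply]
  fin_cases b1 <;> fin_cases b2 <;> fin_cases i <;> simp [Xg, Zg]
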